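/- Let n ≥ 4, p_e ∈ (0,1] and p_d ∈ [1/2,1). If the direction-edge random digraph D(n,p_e,p_d) has a vertex-arc random digraph representation D(n,Ω,μ,φ), then p_d = 1/(1+√(1−p_e)) and φ(x,y) = p_e·p_d for μ×μ-almost every (x,y) ∈ Ω × Ω. -/

import Mathlib

open MeasureTheory Finset

/-- A finset of ordered pairs is (the arc set of) a digraph on `Fin n` if it has no loops. -/
def IsDigraph {n : ℕ} (A : Finset (Fin n × Fin n)) : Prop := ∀ p ∈ A, p.1 ≠ p.2

/-- The number of symmetric arc pairs of a digraph. -/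
def nS {n : ℕ} (A : Finset (Fin n × Fin n)) : ℕ :=
  (A.filter fun p => (p.2, p.1) ∈ A ∧ p.1 < p.2).card

/-- The number of asymmetric arcs of a digraph. -/
def nAS {n : ℕ} (A : Finset (Fin n × Fin n)) : ℕ :=
  (A.filter fun p => (p.2, p.1) ∉ A).card

/-- The number of edges of the underlying graph of a digraph. -/
def nE {n : ℕ} (A : Finset (Fin n × Fin n)) : ℕ := nS A + nAS A

/-- Probability assigned to the digraph with arc set `A` by the direction-edge random digraph
`D(n, p_e, p_d)`. -/
def derdP (n : ℕ) (pe pd : ℝ) (A : Finset (Fin n × Fin n)) : ℝ :=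
  pe ^ nE A * (1 - pe) ^ (n.choose 2 - nE A) * (1 - pd) ^ nAS A * (2 * pd - 1) ^ nS A

/-- The probability that the vertex-arc random digraph `D(n, Ω, μ, φ)` equals the digraph
with arc set `A`. -/
noncomputable def vardP {Ω : Type*} [MeasurableSpace Ω] (μ : Measure Ω) {n : ℕ}
    (φ : Ω → Ω → ℝ) (A : Finset (Fin n × Fin n)) : ℝ :=
  ∫ x : Fin n → Ω,
    (∏ p ∈ A, φ (x p.1) (x p.2)) *
      ∏ p ∈ Finset.univ.filter (fun p : Fin n × Fin n => p.1 ≠ p.2 ∧ p ∉ A),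
        (1 - φ (x p.1) (x p.2)) ∂(Measure.pi fun _ : Fin n => μ)

/-- The pairs `(i, j)` with `i < j`, indexing the edges of the complete graph on `Fin n`. -/
abbrev orderedPairs (n : ℕ) : Finset (Fin n × Fin n) := univ.filter fun q => q.1 < q.2

/-- The pairs `(i, j)` with `i ≠ j`, indexing the arcs of the complete digraph on `Fin n`. -/
abbrev loopless (n : ℕ) : Finset (Fin n × Fin n) := univ.filter fun q => q.1 ≠ q.2

/-- The factor contributed to `derdP` by a pair of vertices, in terms of which of the two arcs
between them are present. -/
def pairWeight (pe pd : ℝ) (s : Bool × Bool) : ℝ :=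
  if s.1 then (if s.2 then pe * (2 * pd - 1) else pe * (1 - pd))
  else (if s.2 then pe * (1 - pd) else 1 - pe)

/-- Which of the two arcs between the end points of `q` belong to `A`. -/
def pairState {n : ℕ} (A : Finset (Fin n × Fin n)) (q : Fin n × Fin n) : Bool × Bool :=
  (decide (q ∈ A), decide (q.swap ∈ A))

lemma prod_loopless {n : ℕ} {M : Type*} [CommMonoid M] (f : Fin n × Fin n → M) :
    ∏ q ∈ loopless n, f q = ∏ q ∈ orderedPairs n, f q * f q.swap := by
  have hswap : ∏ q ∈ orderedPairs n, f q.swap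
      = ∏ q ∈ univ.filter (fun q : Fin n × Fin n => q.2 < q.1), f q :=
    Finset.prod_nbij' Prod.swap Prod.swap (by simp) (by simp) (by simp) (by simp) (by simp)
  have hunion : loopless n
      = orderedPairs n ∪ univ.filter (fun q : Fin n × Fin n => q.2 < q.1) := by
    ext q
    simp [lt_or_lt_iff_ne]
  rw [Finset.prod_mul_distrib, hswap, hunion, Finset.prod_union]
  rw [Finset.disjoint_filter]
  exact fun q _ h => h.asymm

lemma sum_loopless {n : ℕ} {M : Type*} [AddCommMonoid M] (f : Fin n × Fin n → M) :
    ∑ q ∈ loopless n, f q = ∑ q ∈ orderedPairs n, (f q + f q.swap) :=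
  prod_loopless (M := Multiplicative M) f

lemma card_orderedPairs (n : ℕ) : #(orderedPairs n) = n.choose 2 := by
  have h := sum_loopless (n := n) fun _ => 1
  have h2 : loopless n = (univ : Finset (Fin n)).offDiag := by ext; simp
  rw [Finset.sum_const, h2, Finset.offDiag_card, Finset.sum_const] at h
  simp only [Finset.card_univ, Fintype.card_fin, smul_eq_mul, mul_one] at h
  rw [Nat.choose_two_right, Nat.mul_sub, mul_one]
  omega

lemma derdP_eq_prod {n : ℕ} (pe pd : ℝ) {A : Finset (Fin n × Fin n)} (hA : IsDigraph A) :
    derdP n pe pd A = ∏ q ∈ orderedPairs n, pairWeight pe pd (pairState A q) := by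
  have hS : nS A = ∑ q ∈ orderedPairs n, if q ∈ A ∧ q.swap ∈ A then 1 else 0 := by
    rw [← Finset.card_filter, Finset.filter_filter, nS]
    congr 1
    ext q
    simp only [Finset.mem_filter, Finset.mem_univ, true_and, Prod.swap]
    tauto
  have hAS : nAS A = ∑ q ∈ orderedPairs n, ((if q ∈ A ∧ q.swap ∉ A then 1 else 0)
      + if q.swap ∈ A ∧ q ∉ A then 1 else 0) := by
    have h := sum_loopless (n := n) fun q => if q ∈ A ∧ q.swap ∉ A then 1 else 0
    simp only [Prod.swap_swap] at h
    rw [← h, ← Finset.card_filter, Finset.filter_filter, nAS]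
    congr 1
    ext q
    simp only [Finset.mem_filter, Finset.mem_univ, true_and, Prod.swap]
    have := hA q
    tauto
  have hN : n.choose 2 - nE A
      = ∑ q ∈ orderedPairs n, if q ∉ A ∧ q.swap ∉ A then 1 else 0 := by
    refine Nat.sub_eq_of_eq_add ?_
    rw [nE, hS, hAS, ← card_orderedPairs, Finset.card_eq_sum_ones, ← Finset.sum_add_distrib,
      ← Finset.sum_add_distrib]
    refine Finset.sum_congr rfl fun q _ => ?_
    by_cases h1 : q ∈ A <;> by_cases h2 : q.swap ∈ A <;> simp [h1, h2]
  rw [derdP, hN, nE, hS, hAS, ← Finset.sum_add_distrib]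
  simp only [← Finset.prod_pow_eq_pow_sum, ← Finset.prod_mul_distrib]
  refine Finset.prod_congr rfl fun q _ => ?_
  by_cases h1 : q ∈ A <;> by_cases h2 : q.swap ∈ A <;> simp [h1, h2, pairWeight, pairState]

/-- The digraph with a prescribed state on every pair of vertices. -/
def digraphOfStates {n : ℕ} (g : orderedPairs n → Bool × Bool) : Finset (Fin n × Fin n) :=
  univ.filter fun q =>
    (∃ h : q ∈ orderedPairs n, (g ⟨q, h⟩).1 = true) ∨
      ∃ h : q.swap ∈ orderedPairs n, (g ⟨q.swap, h⟩).2 = true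

lemma digraphOfStates_subset {n : ℕ} (g : orderedPairs n → Bool × Bool) :
    digraphOfStates g ⊆ loopless n := by
  intro q hq
  simp only [digraphOfStates, Finset.mem_filter, Finset.mem_univ, true_and] at hq ⊢
  rcases hq with ⟨h, -⟩ | ⟨h, -⟩
  · exact h.ne
  · exact h.ne'

lemma pairState_digraphOfStates {n : ℕ} (g : orderedPairs n → Bool × Bool) (q : orderedPairs n) :
    pairState (digraphOfStates g) q = g q := by
  obtain ⟨q, hq⟩ := q
  have hlt : q.1 < q.2 := by simpa using hq
  ext <;> simp [pairState, digraphOfStates, hlt, hlt.not_gt]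

lemma digraphOfStates_pairState {n : ℕ} {A : Finset (Fin n × Fin n)} (hA : A ⊆ loopless n) :
    digraphOfStates (fun q => pairState A q) = A := by
  ext q
  have hne : q ∈ A → q.1 ≠ q.2 := fun h => by simpa using hA h
  rcases lt_trichotomy q.1 q.2 with h | h | h
  · simp [pairState, digraphOfStates, h, h.not_gt]
  · simpa [pairState, digraphOfStates, h] using fun hq => hne hq h
  · simp [pairState, digraphOfStates, h, h.not_gt]

/-- A sum over all digraphs of a product over pairs of vertices factorises. -/
lemma sum_digraphs_prod {n : ℕ} (F : Fin n × Fin n → Bool × Bool → ℝ) :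
    ∑ A ∈ (loopless n).powerset, ∏ q ∈ orderedPairs n, F q (pairState A q)
      = ∏ q ∈ orderedPairs n, ∑ s, F q s := by
  rw [← Finset.prod_coe_sort, Finset.prod_univ_sum, Fintype.piFinset_univ]
  symm
  refine Finset.sum_nbij' digraphOfStates (fun A q => pairState A q) ?_ (by simp) ?_ ?_ ?_
  · exact fun g _ => Finset.mem_powerset.2 (digraphOfStates_subset g)
  · exact fun g _ => funext (pairState_digraphOfStates g)
  · exact fun A hA => digraphOfStates_pairState (Finset.mem_powerset.1 hA)
  · intro g _
    rw [← Finset.prod_coe_sort (orderedPairs n) fun q => F q (pairState (digraphOfStates g) q)]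
    simp only [pairState_digraphOfStates]

lemma sum_derdP_mul_prod {n : ℕ} (pe pd : ℝ) (a b : Fin n × Fin n → ℝ) :
    ∑ A ∈ (loopless n).powerset,
        derdP n pe pd A * ∏ q ∈ loopless n, (if q ∈ A then a q else b q)
      = ∏ q ∈ orderedPairs n, ∑ s, pairWeight pe pd s *
          ((if s.1 then a q else b q) * (if s.2 then a q.swap else b q.swap)) := by
  rw [← sum_digraphs_prod]
  refine Finset.sum_congr rfl fun A hA => ?_
  have hA' : IsDigraph A := fun q hq => by
    simpa using Finset.mem_powerset.1 hA hq
  rw [derdP_eq_prod pe pd hA', prod_loopless, ← Finset.prod_mul_distrib]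
  simp [pairState]

lemma integrable_prod_apply {Ω : Type*} [MeasurableSpace Ω] {μ : Measure Ω}
    [IsProbabilityMeasure μ] {n : ℕ} {f : Fin n × Fin n → Ω → Ω → ℝ}
    (hmeas : ∀ q, Measurable (Function.uncurry (f q))) (hf : ∀ q x y, |f q x y| ≤ 1)
    (S : Finset (Fin n × Fin n)) :
    Integrable (fun x : Fin n → Ω => ∏ q ∈ S, f q (x q.1) (x q.2))
      (Measure.pi fun _ : Fin n => μ) := by
  refine Integrable.of_bound (C := 1) ?_ ?_
  · refine (Finset.measurable_prod _ fun q _ => ?_).aestronglyMeasurable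
    exact (hmeas q).comp (f := fun x : Fin n → Ω => (x q.1, x q.2)) (by fun_prop)
  · filter_upwards with x
    rw [Real.norm_eq_abs, Finset.abs_prod]
    exact Finset.prod_le_one (fun _ _ => abs_nonneg _) fun q _ => hf q _ _

lemma sum_vardP_mul_prod {Ω : Type*} [MeasurableSpace Ω] (μ : Measure Ω)
    [IsProbabilityMeasure μ] {n : ℕ} {φ : Ω → Ω → ℝ} (hmeas : Measurable (Function.uncurry φ))
    (hφ : ∀ x y, φ x y ∈ Set.Icc (0 : ℝ) 1) (a b : Fin n × Fin n → ℝ) :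
    ∑ A ∈ (loopless n).powerset,
        vardP μ φ A * ∏ q ∈ loopless n, (if q ∈ A then a q else b q)
      = ∫ x : Fin n → Ω, ∏ q ∈ loopless n,
          (a q * φ (x q.1) (x q.2) + b q * (1 - φ (x q.1) (x q.2)))
            ∂(Measure.pi fun _ : Fin n => μ) := by
  have hprod (A) (hA : A ∈ (loopless n).powerset) (u v : Fin n × Fin n → ℝ) :
      ∏ q ∈ loopless n, (if q ∈ A then u q else v q)
        = (∏ q ∈ A, u q) * ∏ q ∈ loopless n \ A, v q := by
    rw [Finset.prod_ite, Finset.filter_mem_eq_inter, Finset.filter_notMem_eq_sdiff,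
      Finset.inter_eq_right.2 (Finset.mem_powerset.1 hA)]
  have hsdiff (A) : univ.filter (fun p : Fin n × Fin n => p.1 ≠ p.2 ∧ p ∉ A)
      = loopless n \ A := by
    ext; simp
  have hinteg (A) (hA : A ∈ (loopless n).powerset) : Integrable (fun x : Fin n → Ω =>
      (∏ q ∈ A, φ (x q.1) (x q.2)) * ∏ q ∈ loopless n \ A, (1 - φ (x q.1) (x q.2)))
      (Measure.pi fun _ : Fin n => μ) := by
    have h := integrable_prod_apply (μ := μ)
      (f := fun q x y => if q ∈ A then φ x y else 1 - φ x y) (fun q => ?_)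
      (fun q x y => ?_) (loopless n)
    · simpa only [hprod A hA] using h
    · by_cases hq : q ∈ A
      · simpa [hq] using hmeas
      · simp only [hq, if_false]
        exact measurable_const.sub hmeas
    · obtain ⟨h0, h1⟩ := hφ x y
      by_cases hq : q ∈ A <;> simp only [hq, if_true, if_false, abs_le] <;>
        constructor <;> linarith
  simp only [Finset.prod_add]
  rw [integral_finsetSum]
  · refine Finset.sum_congr rfl fun A hA => ?_
    rw [hprod A hA, vardP, hsdiff, ← integral_mul_const]
    refine integral_congr_ae (.of_forall fun x => ?_)
    simp only [Finset.prod_mul_distrib]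
    ring
  · intro A hA
    refine ((hinteg A hA).mul_const ((∏ q ∈ A, a q) * ∏ q ∈ loopless n \ A, b q)).congr
      (.of_forall fun x => ?_)
    simp only [Finset.prod_mul_distrib]
    ring

/-- The centred arc indicators of a direction-edge random digraph with a vertex-arc
representation have mixed moments that factorise over pairs of vertices. -/
lemma integral_prod_sub {n : ℕ} {pe pd : ℝ} {Ω : Type*} [MeasurableSpace Ω] (μ : Measure Ω)
    [IsProbabilityMeasure μ] {φ : Ω → Ω → ℝ} (hmeas : Measurable (Function.uncurry φ))
    (hφ : ∀ x y, φ x y ∈ Set.Icc (0 : ℝ) 1)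
    (hrep : ∀ A : Finset (Fin n × Fin n), IsDigraph A → derdP n pe pd A = vardP μ φ A)
    {C : Finset (Fin n × Fin n)} (hC : IsDigraph C) :
    ∫ x : Fin n → Ω, ∏ q ∈ C, (φ (x q.1) (x q.2) - pe * pd) ∂(Measure.pi fun _ : Fin n => μ)
      = ∏ q ∈ orderedPairs n,
          if q ∈ C then
            if q.swap ∈ C then pe * (2 * pd - 1) - (pe * pd) ^ 2 else 0
          else if q.swap ∈ C then 0 else 1 := by
  let a : Fin n × Fin n → ℝ := fun q => if q ∈ C then 1 - pe * pd else 1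
  let b : Fin n × Fin n → ℝ := fun q => if q ∈ C then -(pe * pd) else 1
  have h : _ = _ := (sum_derdP_mul_prod pe pd a b).symm.trans
    ((Finset.sum_congr rfl fun A hA => by
      rw [hrep A fun q hq => by simpa using Finset.mem_powerset.1 hA hq]).trans
      (sum_vardP_mul_prod μ hmeas hφ a b))
  have hsub : C ⊆ loopless n := fun q hq => by simpa using hC q hq
  have hL : (∫ x : Fin n → Ω, ∏ q ∈ C, (φ (x q.1) (x q.2) - pe * pd)
      ∂(Measure.pi fun _ : Fin n => μ)) = ∫ x : Fin n → Ω, ∏ q ∈ loopless n,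
        (a q * φ (x q.1) (x q.2) + b q * (1 - φ (x q.1) (x q.2)))
          ∂(Measure.pi fun _ : Fin n => μ) := by
    refine integral_congr_ae (.of_forall fun x => ?_)
    refine Finset.prod_subset_one_on_sdiff hsub (fun q hq => ?_) fun q hq => ?_
    · simp [a, b, (Finset.mem_sdiff.1 hq).2]
    · simp only [a, b, hq, if_true]
      ring
  rw [hL, ← h]
  refine Finset.prod_congr rfl fun q _ => ?_
  by_cases h1 : q ∈ C <;> by_cases h2 : q.swap ∈ C <;>
    simp [a, b, h1, h2, Fintype.sum_prod_type, pairWeight] <;> ring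

lemma ae_eq_zero_of_setIntegral_prod_eq_zero {α β : Type*} [MeasurableSpace α]
    [MeasurableSpace β] {μ : Measure (α × β)} [IsFiniteMeasure μ] {f : α × β → ℝ}
    (hf : Integrable f μ)
    (h : ∀ s t, MeasurableSet s → MeasurableSet t → ∫ z in s ×ˢ t, f z ∂μ = 0) :
    f =ᵐ[μ] 0 := by
  refine ae_eq_zero_of_forall_setIntegral_eq_of_sigmaFinite (fun _ _ _ => hf.integrableOn)
    fun s hs hlt => ?_
  clear hlt
  induction s, hs using MeasurableSpace.induction_on_inter generateFrom_prod.symm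
    isPiSystem_prod with
  | empty => simp
  | basic s hs =>
    obtain ⟨s, hs, t, ht, rfl⟩ := hs
    exact h s t hs ht
  | compl s hs ih =>
    have hu := h .univ .univ .univ .univ
    rw [Set.univ_prod_univ, setIntegral_univ] at hu
    rw [setIntegral_compl hs hf, ih, hu, sub_zero]
  | iUnion s hd hs ih =>
    rw [integral_iUnion hs hd hf.integrableOn]
    simp [ih]

/-- A bounded kernel whose four-cycle integral vanishes is zero almost everywhere. -/
lemma ae_eq_zero_of_integral_fourCycle_eq_zero {Ω : Type*} [MeasurableSpace Ω] {μ : Measure Ω}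
    [IsProbabilityMeasure μ] {ψ : Ω → Ω → ℝ} (hmeas : Measurable (Function.uncurry ψ))
    (hψ : ∀ x y, |ψ x y| ≤ 1)
    (h : ∫ z, ψ z.1.1 z.2.1 * ψ z.1.2 z.2.1 * (ψ z.1.1 z.2.2 * ψ z.1.2 z.2.2)
      ∂((μ.prod μ).prod (μ.prod μ)) = 0) :
    ∀ᵐ q ∂(μ.prod μ), ψ q.1 q.2 = 0 := by
  have hmeas' {γ : Type _} [MeasurableSpace γ] {f g : γ → Ω} (hf : Measurable f)
      (hg : Measurable g) : Measurable fun c => ψ (f c) (g c) := hmeas.comp (hf.prodMk hg)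
  have hψ2 (x x' y : Ω) : |ψ x y * ψ x' y| ≤ 1 := by
    rw [abs_mul]
    exact mul_le_one₀ (hψ _ _) (abs_nonneg _) (hψ _ _)
  have hinteg {γ : Type _} [MeasurableSpace γ] {m : Measure γ} [IsFiniteMeasure m] {f : γ → ℝ}
      (hf : Measurable f) (hb : ∀ c, |f c| ≤ 1) : Integrable f m :=
    Integrable.of_bound hf.aestronglyMeasurable 1 (.of_forall hb)
  let K : Ω × Ω → ℝ := fun z => ∫ y, ψ z.1 y * ψ z.2 y ∂μ
  have hG : Measurable fun z : (Ω × Ω) × Ω => ψ z.1.1 z.2 * ψ z.1.2 z.2 :=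
    (hmeas' (by fun_prop) (by fun_prop)).mul (hmeas' (by fun_prop) (by fun_prop))
  have hKm : Measurable K := hG.stronglyMeasurable.integral_prod_right'.measurable
  have hKb (z) : |K z| ≤ 1 := by
    simpa [K] using norm_integral_le_of_norm_le_const (μ := μ)
      (f := fun y => ψ z.1 y * ψ z.2 y) (C := 1) (.of_forall fun y => hψ2 z.1 z.2 y)
  have hK : K =ᵐ[μ.prod μ] 0 := by
    rw [integral_prod _ (hinteg ?_ ?_)] at h
    · have hKK (z : Ω × Ω) : ∫ w, ψ z.1 w.1 * ψ z.2 w.1 * (ψ z.1 w.2 * ψ z.2 w.2) ∂(μ.prod μ)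
          = K z * K z :=
        integral_prod_mul (fun y => ψ z.1 y * ψ z.2 y) (fun y => ψ z.1 y * ψ z.2 y)
      simp only [hKK] at h
      have h0 := (integral_eq_zero_iff_of_nonneg (μ := μ.prod μ) (f := fun z => K z * K z)
        (fun z => mul_self_nonneg _) (hinteg (hKm.mul hKm) fun z => ?_)).1 h
      · filter_upwards [h0] with z hz using mul_self_eq_zero.1 hz
      · rw [abs_mul]
        exact mul_le_one₀ (hKb _) (abs_nonneg _) (hKb _)
    · exact (hG.comp (by fun_prop : Measurable fun z : (Ω × Ω) × (Ω × Ω) => (z.1, z.2.1))).mul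
        (hG.comp (by fun_prop : Measurable fun z : (Ω × Ω) × (Ω × Ω) => (z.1, z.2.2)))
    · intro z
      rw [abs_mul]
      exact mul_le_one₀ (hψ2 _ _ _) (abs_nonneg _) (hψ2 _ _ _)
  have hslice (s : Set Ω) : ∀ᵐ y ∂μ, ∫ x in s, ψ x y ∂μ = 0 := by
    let F : Ω → ℝ := fun y => ∫ x in s, ψ x y ∂μ
    have hFm : Measurable F :=
      (hmeas.stronglyMeasurable.integral_prod_left' (μ := μ.restrict s)).measurable
    have hFb (y) : |F y| ≤ 1 := by
      refine (norm_integral_le_of_norm_le_const (μ := μ.restrict s)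
        (f := fun x => ψ x y) (C := 1) (.of_forall fun x => hψ x y)).trans ?_
      simp [measureReal_le_one]
    have hFF (y) : F y * F y
        = ∫ z, ψ z.1 y * ψ z.2 y ∂((μ.restrict s).prod (μ.restrict s)) :=
      (integral_prod_mul (fun x => ψ x y) (fun x => ψ x y)).symm
    have hF0 : ∫ y, F y * F y ∂μ = 0 := by
      simp only [hFF]
      rw [integral_integral_swap]
      · rw [Measure.prod_restrict]
        exact integral_eq_zero_of_ae (ae_restrict_of_ae hK)
      · exact hinteg (hG.comp measurable_swap) fun z => hψ2 _ _ _
    have h0 := (integral_eq_zero_iff_of_nonneg (μ := μ) (f := fun y => F y * F y)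
        (fun z => mul_self_nonneg _) (hinteg (hFm.mul hFm) fun z => ?_)).1 hF0
    · filter_upwards [h0] with z hz using mul_self_eq_zero.1 hz
    · rw [abs_mul]
      exact mul_le_one₀ (hFb _) (abs_nonneg _) (hFb _)
  refine ae_eq_zero_of_setIntegral_prod_eq_zero (f := Function.uncurry ψ)
    (hinteg hmeas fun z => hψ _ _) fun s t _ _ => ?_
  rw [← Measure.prod_restrict, integral_prod_symm _ (hinteg hmeas fun z => hψ _ _)]
  exact integral_eq_zero_of_ae (ae_restrict_of_ae (hslice s))

lemma map_pi_pair {ι Ω : Type*} [Fintype ι] [MeasurableSpace Ω] (μ : Measure Ω)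
    [IsProbabilityMeasure μ] {i j : ι} (hij : i ≠ j) :
    (Measure.pi fun _ : ι => μ).map (fun x => (x i, x j)) = μ.prod μ := by
  have hind := ProbabilityTheory.iIndepFun_pi (μ := fun _ : ι => μ) (X := fun _ => id)
    fun _ => aemeasurable_id
  simp only [id] at hind
  rw [(hind.indepFun hij).map_prod_eq_prod_map_map (measurable_pi_apply i).aemeasurable
    (measurable_pi_apply j).aemeasurable]
  exact congr_arg₂ _ (measurePreserving_eval _ i).map_eq (measurePreserving_eval _ j).map_eq

lemma map_pi_pair_pair {ι Ω : Type*} [Fintype ι] [MeasurableSpace Ω] (μ : Measure Ω)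
    [IsProbabilityMeasure μ] {i j k l : ι} (hij : i ≠ j) (hkl : k ≠ l) (hik : i ≠ k)
    (hil : i ≠ l) (hjk : j ≠ k) (hjl : j ≠ l) :
    (Measure.pi fun _ : ι => μ).map (fun x => ((x i, x j), (x k, x l)))
      = (μ.prod μ).prod (μ.prod μ) := by
  have hind := ProbabilityTheory.iIndepFun_pi (μ := fun _ : ι => μ) (X := fun _ => id)
    fun _ => aemeasurable_id
  have h := (hind.indepFun_prodMk_prodMk (fun _ => by fun_prop) i j k l hik hil hjk
    hjl).map_prod_eq_prod_map_map (by fun_prop) (by fun_prop)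
  simp only [id] at h
  rw [h, map_pi_pair μ hij, map_pi_pair μ hkl]

/-- If a direction-edge random digraph `D(n, p_e, p_d)` with `n ≥ 4` has a vertex-arc random
digraph representation `D(n, Ω, μ, φ)`, then `p_d = 1/(1+√(1-p_e))` and `φ = p_e p_d`
almost surely with respect to `μ × μ`. -/
theorem stmt6 {n : ℕ} (hn : 4 ≤ n) {pe pd : ℝ}
    (hpe0 : 0 < pe) (hpe1 : pe ≤ 1) (hpd0 : 1 / 2 ≤ pd) (hpd1 : pd < 1)
    {Ω : Type*} [MeasurableSpace Ω] (μ : Measure Ω) [IsProbabilityMeasure μ]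
    (φ : Ω → Ω → ℝ) (hmeas : Measurable (Function.uncurry φ))
    (hφ : ∀ x y, φ x y ∈ Set.Icc (0 : ℝ) 1)
    (hrep : ∀ A : Finset (Fin n × Fin n), IsDigraph A → derdP n pe pd A = vardP μ φ A) :
    pd = 1 / (1 + Real.sqrt (1 - pe)) ∧ ∀ᵐ q ∂(μ.prod μ), φ q.1 q.2 = pe * pd := by
  let v : Fin 4 → Fin n := Fin.castLE hn
  have hv {i j : Fin 4} (hij : i < j) : v i < v j := hij
  have h01 := hv (show (0 : Fin 4) < 1 by decide)
  have h02 := hv (show (0 : Fin 4) < 2 by decide)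
  have h03 := hv (show (0 : Fin 4) < 3 by decide)
  have h12 := hv (show (1 : Fin 4) < 2 by decide)
  have h13 := hv (show (1 : Fin 4) < 3 by decide)
  have h23 := hv (show (2 : Fin 4) < 3 by decide)
  have hψm : Measurable (Function.uncurry fun x y => φ x y - pe * pd) :=
    hmeas.sub measurable_const
  have hp0 : 0 ≤ pe * pd := by positivity
  have hp1 : pe * pd ≤ 1 := mul_le_one₀ hpe1 (by linarith) hpd1.le
  have hψ : ∀ᵐ q ∂(μ.prod μ), φ q.1 q.2 - pe * pd = 0 := by
    refine ae_eq_zero_of_integral_fourCycle_eq_zero hψm (fun x y => ?_) ?_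
    · obtain ⟨h0, h1⟩ := hφ x y
      rw [abs_le]
      constructor <;> linarith
    rw [← map_pi_pair_pair μ h01.ne h23.ne h02.ne h03.ne h12.ne h13.ne, integral_map]
    · have h := integral_prod_sub μ hmeas hφ hrep
        (C := {(v 0, v 2), (v 1, v 2), (v 0, v 3), (v 1, v 3)}) (by
          simp [IsDigraph, h02.ne, h03.ne, h12.ne, h13.ne])
      rw [Finset.prod_eq_zero (i := (v 0, v 2)) (by simpa using h02)
        (by simp [h02.ne, h02.ne', h23.ne, h03.ne, h12.ne'])] at h
      rw [← h]
      refine integral_congr_ae (.of_forall fun x => ?_)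
      simp [Finset.prod_insert, h01.ne, h23.ne, h01.ne', mul_assoc]
    · fun_prop
    · have hm {f g : (Ω × Ω) × (Ω × Ω) → Ω} (hf : Measurable f) (hg : Measurable g) :
          Measurable fun c => φ (f c) (g c) - pe * pd := hψm.comp (hf.prodMk hg)
      exact (((hm (by fun_prop) (by fun_prop)).mul (hm (by fun_prop) (by fun_prop))).mul
        ((hm (by fun_prop) (by fun_prop)).mul
          (hm (by fun_prop) (by fun_prop)))).aestronglyMeasurable
  refine ⟨?_, by filter_upwards [hψ] with q hq using sub_eq_zero.1 hq⟩
  have hpair : pe * (2 * pd - 1) - (pe * pd) ^ 2 = 0 := by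
    have h := integral_prod_sub μ hmeas hφ hrep (C := {(v 0, v 1), (v 1, v 0)})
      (by simp [IsDigraph, h01.ne, h01.ne'])
    rw [Finset.prod_eq_single (v 0, v 1) ?_ ?_] at h
    · simp only [Finset.mem_insert, Finset.mem_singleton, Prod.swap, true_or, or_true,
        if_true] at h
      rw [← h]
      refine integral_eq_zero_of_ae ?_
      rw [← map_pi_pair μ h01.ne] at hψ
      filter_upwards [ae_of_ae_map (by fun_prop) hψ] with x hx
      simp [Finset.prod_insert, h01.ne, hx]
    · rintro ⟨i, j⟩ hq hne
      have hlt : i < j := by simpa using hq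
      have h10 : ¬ (i = v 1 ∧ j = v 0) := by
        rintro ⟨rfl, rfl⟩
        exact hlt.not_gt h01
      have h01' : ¬ (i = v 0 ∧ j = v 1) := by
        simpa using hne
      have h10' : ¬ (j = v 1 ∧ i = v 0) := fun h => h01' h.symm
      have h01'' : ¬ (j = v 0 ∧ i = v 1) := fun h => h10 h.symm
      simp [h10, h01', h10', h01'']
    · simp [h01]
  have hsq : (1 - pd) ^ 2 = pd ^ 2 * (1 - pe) := by
    have : pe * (2 * pd - 1 - pe * pd ^ 2) = 0 := by linear_combination hpair
    have := (mul_eq_zero.1 this).resolve_left hpe0.ne'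
    linear_combination -this
  have hsqrt : 1 - pd = pd * Real.sqrt (1 - pe) := by
    rw [← Real.sqrt_sq (by linarith : 0 ≤ 1 - pd), hsq, Real.sqrt_mul (sq_nonneg _),
      Real.sqrt_sq (by linarith)]
  rw [eq_div_iff (by positivity)]
  linear_combination -hsqrt
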